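/- arXiv:1801.06420 — 5 statements merged into one kernel-verified Lean document; each statement's English description precedes it below -/
import Mathlib

section
/- Let s be a 3×3 complex matrix which is unitary (s†s = I), has det s = 1, and satisfies s₃₃ ≠ 0. Then there exists a unique 3×3 complex matrix S₁ such that (S₁)₁₃ = (S₁)₂₃ = 0 and (s⁻¹S₁)_{jl} = δ_{jl} for every index pair (j,l) other than (1,3) and (2,3); moreover this S₁ is given explicitly by: its first column is (s₁₁, s₂₁, s₃₁)ᵀ, its second column is (s₁₂, s₂₂, s₃₂)ᵀ, and its third column is (0, 0, 1/conj(s₃₃))ᵀ. -/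
open Matrix Complex

noncomputable section

/-- For a unitary 3×3 matrix `s` with `det s = 1` and `s₃₃ ≠ 0`, there is a
unique matrix `S₁` with `(S₁)₁₃ = (S₁)₂₃ = 0` and `(s⁻¹ S₁)_{jl} = δ_{jl}` for all index
pairs other than `(1,3)` and `(2,3)`, and it is given explicitly. -/
theorem statement0 (s : Matrix (Fin 3) (Fin 3) ℂ)
    (hunit : sᴴ * s = 1) (hdet : s.det = 1) (h33 : s 2 2 ≠ 0) :
    ∀ S₁ : Matrix (Fin 3) (Fin 3) ℂ,
      (S₁ 0 2 = 0 ∧ S₁ 1 2 = 0 ∧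
        ∀ j l : Fin 3, ¬(j = 0 ∧ l = 2) → ¬(j = 1 ∧ l = 2) →
          (s⁻¹ * S₁) j l = (1 : Matrix (Fin 3) (Fin 3) ℂ) j l)
      ↔ S₁ = !![s 0 0, s 0 1, 0;
                 s 1 0, s 1 1, 0;
                 s 2 0, s 2 1, ((starRingEnd ℂ) (s 2 2))⁻¹] := by
  intro S₁
  have hinv : s⁻¹ = sᴴ := Matrix.inv_eq_left_inv hunit
  have hunit' : s * sᴴ = 1 := mul_eq_one_comm.mp hunit
  have hc : (starRingEnd ℂ) (s 2 2) ≠ 0 := by simpa using h33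
  rw [hinv]
  constructor
  · rintro ⟨h0, h1, h⟩
    have hS : S₁ = s * (sᴴ * S₁) := by rw [← Matrix.mul_assoc, hunit', Matrix.one_mul]
    have col : ∀ i l : Fin 3, l ≠ 2 → S₁ i l = s i l := by
      intro i l hl
      have e : S₁ i l = (s * (sᴴ * S₁)) i l := by rw [← hS]
      rw [e, Matrix.mul_apply]
      have : ∀ j, (sᴴ * S₁) j l = (1 : Matrix (Fin 3) (Fin 3) ℂ) j l := fun j =>
        h j l (fun a => hl a.2) (fun a => hl a.2)
      simp only [this]
      rw [← Matrix.mul_apply, Matrix.mul_one]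
    have h22 := h 2 2 (by decide) (by decide)
    simp [Matrix.mul_apply, Fin.sum_univ_three, h0, h1] at h22
    have h22' : S₁ 2 2 = ((starRingEnd ℂ) (s 2 2))⁻¹ := eq_inv_of_mul_eq_one_right h22
    ext i l
    fin_cases i <;> fin_cases l <;> simp [h0, h1, h22', col]
  · intro hS
    refine ⟨by simp [hS], by simp [hS], ?_⟩
    intro j l hj hj'
    by_cases hl : l = 2
    · have : j = 2 := by
        fin_cases j <;> simp_all
      subst hl this
      simp [Matrix.mul_apply, Fin.sum_univ_three, hS, h33]
    · have col : ∀ i, S₁ i l = s i l := by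
        intro i
        fin_cases i <;> fin_cases l <;> simp_all
      rw [← hunit]
      simp only [Matrix.mul_apply, col]
end
end

section
/- Let s be a 3×3 complex matrix which is unitary (s†s = I), has det s = 1, and satisfies s₃₃ ≠ 0. Then there exists a unique 3×3 complex matrix S₂ such that (S₂)₃₁ = (S₂)₃₂ = 0 and (s⁻¹S₂)_{jl} = δ_{jl} for every index pair (j,l) other than (3,1) and (3,2); moreover this S₂ is given explicitly by the matrix with rows (conj(s₂₂)/s₃₃, −conj(s₂₁)/s₃₃, s₁₃), (−conj(s₁₂)/s₃₃, conj(s₁₁)/s₃₃, s₂₃), (0, 0, s₃₃). -/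
open Matrix Complex

noncomputable section

/-- For a unitary 3×3 matrix `s` with `det s = 1` and `s₃₃ ≠ 0`, there is a
unique matrix `S₂` with `(S₂)₃₁ = (S₂)₃₂ = 0` and `(s⁻¹ S₂)_{jl} = δ_{jl}` for all index
pairs other than `(3,1)` and `(3,2)`, and it is given explicitly. -/
theorem statement1 (s : Matrix (Fin 3) (Fin 3) ℂ)
    (hunit : sᴴ * s = 1) (hdet : s.det = 1) (h33 : s 2 2 ≠ 0) :
    ∀ S₂ : Matrix (Fin 3) (Fin 3) ℂ,
      (S₂ 2 0 = 0 ∧ S₂ 2 1 = 0 ∧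
        ∀ j l : Fin 3, ¬(j = 2 ∧ l = 0) → ¬(j = 2 ∧ l = 1) →
          (s⁻¹ * S₂) j l = (1 : Matrix (Fin 3) (Fin 3) ℂ) j l)
      ↔ S₂ = !![(starRingEnd ℂ) (s 1 1) / s 2 2, -(starRingEnd ℂ) (s 1 0) / s 2 2, s 0 2;
                 -(starRingEnd ℂ) (s 0 1) / s 2 2, (starRingEnd ℂ) (s 0 0) / s 2 2, s 1 2;
                 0, 0, s 2 2] := by
  have hu : IsUnit s.det := by rw [hdet]; exact isUnit_one
  have hinv : s⁻¹ = s.adjugate := by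
    rw [Matrix.inv_def, hdet]; simp
  have hadj : sᴴ = s.adjugate := by
    rw [← hinv]; exact (Matrix.inv_eq_left_inv hunit).symm
  have hc : ∀ i j, (starRingEnd ℂ) (s i j) = s.adjugate j i := by
    intro i j
    rw [← hadj]; rfl
  have hE : !![(starRingEnd ℂ) (s 1 1) / s 2 2, -(starRingEnd ℂ) (s 1 0) / s 2 2, s 0 2;
                 -(starRingEnd ℂ) (s 0 1) / s 2 2, (starRingEnd ℂ) (s 0 0) / s 2 2, s 1 2;
                 0, 0, s 2 2]
      = s * !![1, 0, 0; 0, 1, 0; -s 2 0 / s 2 2, -s 2 1 / s 2 2, 1] := by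
    simp only [hc, Matrix.adjugate_fin_three]
    ext i j
    fin_cases i <;> fin_cases j <;>
      simp [Matrix.mul_apply, Fin.sum_univ_three] <;> field_simp <;> ring
  intro S₂
  rw [hE]
  constructor
  · rintro ⟨h0, h1, h⟩
    have hS : S₂ = s * (s⁻¹ * S₂) := (Matrix.mul_nonsing_inv_cancel_left _ _ hu).symm
    generalize s⁻¹ * S₂ = T at hS h
    subst hS
    congr 1
    have e00 := h 0 0 (by decide) (by decide)
    have e01 := h 0 1 (by decide) (by decide)
    have e02 := h 0 2 (by decide) (by decide)
    have e10 := h 1 0 (by decide) (by decide)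
    have e11 := h 1 1 (by decide) (by decide)
    have e12 := h 1 2 (by decide) (by decide)
    have e22 := h 2 2 (by decide) (by decide)
    simp at e00 e01 e02 e10 e11 e12 e22
    simp [Matrix.mul_apply, Fin.sum_univ_three, e00, e01, e10, e11] at h0 h1
    have e20 : T 2 0 = -s 2 0 / s 2 2 := by
      rw [eq_div_iff h33]; linear_combination h0
    have e21 : T 2 1 = -s 2 1 / s 2 2 := by
      rw [eq_div_iff h33]; linear_combination h1
    ext i j
    fin_cases i <;> fin_cases j <;> simp [*]
  · rintro rfl
    rw [Matrix.nonsing_inv_mul_cancel_left _ _ hu]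
    refine ⟨?_, ?_, ?_⟩
    · simp [Matrix.mul_apply, Fin.sum_univ_three]; field_simp; ring
    · simp [Matrix.mul_apply, Fin.sum_univ_three]; field_simp; ring
    · intro j l
      fin_cases j <;> fin_cases l <;> simp
end
end

section
/- Let u : ℝ → ℂ be continuous, let k ∈ ℂ, and for x ∈ ℝ set Ũ(x,k) := −ik·σ + U(u(x)). Suppose ψ₁, ψ₂ : ℝ → M₃(ℂ) are differentiable and satisfy ψ₁′(x) = Ũ(x,k)·ψ₁(x) and ψ₂′(x) = Ũ(x, conj(k))·ψ₂(x) for all x ∈ ℝ. Then the function x ↦ ψ₂(x)†·ψ₁(x) is constant on ℝ. -/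
open Matrix Complex

noncomputable section

attribute [local instance] Matrix.normedAddCommGroup Matrix.normedSpace

/-- The diagonal matrix σ = diag(1,1,−1). -/
def sigma3 : Matrix (Fin 3) (Fin 3) ℂ := !![1, 0, 0; 0, 1, 0; 0, 0, -1]

/-- The potential matrix U(u). -/
def Umat (u : ℂ) : Matrix (Fin 3) (Fin 3) ℂ :=
  !![0, 0, u; 0, 0, (starRingEnd ℂ) u; -(starRingEnd ℂ) u, -u, 0]

/-- The coefficient matrix Ũ(x,k) = −ik·σ + U(u(x)). -/
def Ut (u : ℝ → ℂ) (k : ℂ) (x : ℝ) : Matrix (Fin 3) (Fin 3) ℂ :=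
  (-(Complex.I * k)) • sigma3 + Umat (u x)

/-- If ψ₁′ = Ũ(x,k)ψ₁ and ψ₂′ = Ũ(x, conj k)ψ₂, then x ↦ ψ₂(x)† ψ₁(x) is
constant. -/
theorem statement3 (u : ℝ → ℂ) (hu : Continuous u) (k : ℂ)
    (ψ₁ ψ₂ : ℝ → Matrix (Fin 3) (Fin 3) ℂ)
    (h₁ : ∀ x : ℝ, HasDerivAt ψ₁ (Ut u k x * ψ₁ x) x)
    (h₂ : ∀ x : ℝ, HasDerivAt ψ₂ (Ut u ((starRingEnd ℂ) k) x * ψ₂ x) x) :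
    ∀ x y : ℝ, (ψ₂ x)ᴴ * ψ₁ x = (ψ₂ y)ᴴ * ψ₁ y := by
  have e₁ : ∀ (x : ℝ) (i j : Fin 3),
      HasDerivAt (fun t => ψ₁ t i j) ((Ut u k x * ψ₁ x) i j) x := fun x i j =>
    hasDerivAt_pi.1 (hasDerivAt_pi.1 (h₁ x) i) j
  have e₂ : ∀ (x : ℝ) (i j : Fin 3),
      HasDerivAt (fun t => ψ₂ t i j) ((Ut u ((starRingEnd ℂ) k) x * ψ₂ x) i j) x := fun x i j =>
    hasDerivAt_pi.1 (hasDerivAt_pi.1 (h₂ x) i) j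
  have key : ∀ x : ℝ, (Ut u ((starRingEnd ℂ) k) x)ᴴ = - Ut u k x := by
    intro x
    ext i j
    fin_cases i <;> fin_cases j <;> simp [Ut, sigma3, Umat, Matrix.conjTranspose_apply]
  have d : ∀ (i j : Fin 3) (x : ℝ),
      HasDerivAt (fun t => ((ψ₂ t)ᴴ * ψ₁ t) i j) 0 x := by
    intro i j x
    have h := HasDerivAt.fun_sum (u := Finset.univ) (fun (l : Fin 3) _ =>
      ((e₂ x l i).star).mul (e₁ x l j))
    have hz : ((Ut u ((starRingEnd ℂ) k) x * ψ₂ x)ᴴ * ψ₁ x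
        + (ψ₂ x)ᴴ * (Ut u k x * ψ₁ x)) i j = 0 := by
      rw [Matrix.conjTranspose_mul, key]
      simp [Matrix.mul_assoc]
    refine h.congr_deriv ?_
    rw [← hz, Matrix.add_apply, Matrix.mul_apply, Matrix.mul_apply (M := (ψ₂ x)ᴴ),
      ← Finset.sum_add_distrib]
    rfl
  intro x y
  ext i j
  exact is_const_of_deriv_eq_zero (fun t => (d i j t).differentiableAt)
    (fun t => (d i j t).deriv) x y
end
end

section
/- Let u : ℝ → ℂ be continuous, let k ∈ ℂ, and for x ∈ ℝ set Ũ(x,k) := −ik·σ + U(u(x)). Suppose φ : ℝ → M₃(ℂ) is differentiable and satisfies φ′(x) = Ũ(x, −conj(k))·φ(x) for all x ∈ ℝ. Then the function ψ(x) := Γ·conj(φ(x))·Γ (entrywise complex conjugation) satisfies ψ′(x) = Ũ(x,k)·ψ(x) for all x ∈ ℝ. -/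
open Matrix Complex

noncomputable section

attribute [local instance] Matrix.normedAddCommGroup Matrix.normedSpace

/-- The permutation matrix Γ. -/
def Gam : Matrix (Fin 3) (Fin 3) ℂ := !![0, 1, 0; 1, 0, 0; 0, 0, 1]

/-- If φ′ = Ũ(x, −conj k)φ, then ψ(x) = Γ·conj(φ(x))·Γ satisfies
ψ′ = Ũ(x,k)ψ. -/
theorem statement4 (u : ℝ → ℂ) (hu : Continuous u) (k : ℂ)
    (φ : ℝ → Matrix (Fin 3) (Fin 3) ℂ)
    (hφ : ∀ x : ℝ, HasDerivAt φ (Ut u (-(starRingEnd ℂ) k) x * φ x) x) :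
    ∀ x : ℝ,
      HasDerivAt (fun y : ℝ => Gam * (φ y).map (starRingEnd ℂ) * Gam)
        (Ut u k x * (Gam * (φ x).map (starRingEnd ℂ) * Gam)) x := by
  intro x
  let L : Matrix (Fin 3) (Fin 3) ℂ →ₗ[ℝ] Matrix (Fin 3) (Fin 3) ℂ :=
    { toFun := fun A => Gam * A.map (starRingEnd ℂ) * Gam
      map_add' := by
        intro A B
        rw [Matrix.map_add _ (map_add _), Matrix.mul_add, Matrix.add_mul]
      map_smul' := by
        intro c A
        have h : (c • A).map (starRingEnd ℂ) = c • A.map (starRingEnd ℂ) := by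
          ext i j
          simp
        rw [h, Matrix.mul_smul, Matrix.smul_mul]
        rfl }
  have hL := (L.toContinuousLinearMap.hasFDerivAt (x := φ x)).comp_hasDerivAt x (hφ x)
  have hU : Gam * (Ut u (-(starRingEnd ℂ) k) x).map (starRingEnd ℂ) = Ut u k x * Gam := by
    ext i j
    fin_cases i <;> fin_cases j <;>
      simp [Gam, Ut, sigma3, Umat, Matrix.mul_apply, Fin.sum_univ_three]
  have hE : Ut u k x * (Gam * (φ x).map (starRingEnd ℂ) * Gam)
      = L.toContinuousLinearMap (Ut u (-(starRingEnd ℂ) k) x * φ x) := by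
    change _ = Gam * (Ut u (-(starRingEnd ℂ) k) x * φ x).map (starRingEnd ℂ) * Gam
    rw [Matrix.map_mul, ← Matrix.mul_assoc Gam, hU]
    simp only [Matrix.mul_assoc]
  rw [hE]
  exact hL
end
end

section
/- Let k₀ > 0 and let h : ℝ → ℝ be continuous. Let k ∈ ℂ with k ∉ [−k₀, k₀]. Then (k − k₀)/(k + k₀) does not lie in the half-line (−∞, 0], and, setting ν := h(k₀)/(2π) and χ(k) := (1/(2πi))·∫_{−k₀}^{k₀} (h(ξ) − h(k₀))/(ξ − k) dξ, one has exp{(1/(2πi))·∫_{−k₀}^{k₀} h(ξ)/(ξ − k) dξ} = ((k − k₀)/(k + k₀))^{−iν} · e^{χ(k)}, where z^{−iν} := exp(−iν·Log z) with Log the principal branch of the complex logarithm. -/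
open Complex intervalIntegral

noncomputable section


lemma ratio_aux (k₀ : ℝ) (hk₀ : 0 < k₀)
    (k : ℂ) (hk : k ∉ (fun x : ℝ => (x : ℂ)) '' Set.Icc (-k₀) k₀) (x : ℝ)
    (hx : x ∈ Set.Icc (-k₀) k₀) :
    ¬ ∃ r : ℝ, r ≤ 0 ∧ (k - (x : ℂ)) / (k + (k₀ : ℂ)) = (r : ℂ) := by
  rintro ⟨r, hr, he⟩
  have h0 : k + (k₀ : ℂ) ≠ 0 := by
    intro h0
    apply hk
    refine ⟨-k₀, ⟨le_refl _, by linarith⟩, ?_⟩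
    push_cast
    linear_combination -h0
  rw [div_eq_iff h0] at he
  have h1 : (0 : ℝ) < 1 - r := by linarith
  have h1' : (1 - r : ℂ) ≠ 0 := by exact_mod_cast h1.ne'
  apply hk
  refine ⟨(x + r * k₀) / (1 - r), ⟨?_, ?_⟩, ?_⟩
  · rw [le_div_iff₀ h1]
    nlinarith [hx.1]
  · rw [div_le_iff₀ h1]
    nlinarith [hx.2, mul_nonneg (neg_nonneg.2 hr) hk₀.le]
  · push_cast
    rw [div_eq_iff h1']
    linear_combination -he

lemma ratio_slit (z : ℂ) (hz : ¬ ∃ r : ℝ, r ≤ 0 ∧ z = (r : ℂ)) : z ∈ Complex.slitPlane := by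
  rw [Complex.mem_slitPlane_iff]
  by_contra! hc
  exact hz ⟨z.re, hc.1, Complex.ext (by simp) (by simp [hc.2])⟩

/-- The explicit Plemelj-formula evaluation (3.5)–(3.7): for k off the real
interval [−k₀, k₀], the ratio (k−k₀)/(k+k₀) avoids the half-line (−∞,0], and
exp{(1/2πi)∫_{−k₀}^{k₀} h(ξ)/(ξ−k) dξ} = ((k−k₀)/(k+k₀))^{−iν} e^{χ(k)}, with
ν = h(k₀)/(2π) and χ(k) = (1/2πi)∫_{−k₀}^{k₀} (h(ξ)−h(k₀))/(ξ−k) dξ, where the power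
is defined via the principal branch of the logarithm. -/
theorem statement12 (k₀ : ℝ) (hk₀ : 0 < k₀) (h : ℝ → ℝ) (hh : Continuous h)
    (k : ℂ) (hk : k ∉ (fun x : ℝ => (x : ℂ)) '' Set.Icc (-k₀) k₀) :
    (¬ ∃ r : ℝ, r ≤ 0 ∧ (k - (k₀ : ℂ)) / (k + (k₀ : ℂ)) = (r : ℂ)) ∧
    Complex.exp ((1 / (2 * Real.pi * Complex.I)) *
        ∫ ξ in (-k₀)..k₀, (h ξ : ℂ) / ((ξ : ℂ) - k)) =
      Complex.exp (-(Complex.I * ((h k₀ / (2 * Real.pi) : ℝ) : ℂ)) *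
          Complex.log ((k - (k₀ : ℂ)) / (k + (k₀ : ℂ)))) *
        Complex.exp ((1 / (2 * Real.pi * Complex.I)) *
          ∫ ξ in (-k₀)..k₀, ((h ξ - h k₀ : ℝ) : ℂ) / ((ξ : ℂ) - k)) := by
  have hne : ∀ x ∈ Set.Icc (-k₀) k₀, (x : ℂ) - k ≠ 0 := by
    intro x hx h0
    exact hk ⟨x, hx, sub_eq_zero.1 h0⟩
  have h0 : k + (k₀ : ℂ) ≠ 0 := by
    have := hne (-k₀) ⟨le_refl _, by linarith⟩
    intro h0
    apply this
    push_cast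
    linear_combination -h0
  have hu : Set.uIcc (-k₀) k₀ = Set.Icc (-k₀) k₀ := Set.uIcc_of_le (by linarith)
  have hc : ∀ g : ℝ → ℂ, Continuous g →
      IntervalIntegrable (fun x : ℝ => g x / ((x : ℂ) - k)) MeasureTheory.volume (-k₀) k₀ := by
    intro g hg
    apply ContinuousOn.intervalIntegrable
    rw [hu]
    exact hg.continuousOn.div (by fun_prop) hne
  have hI : ∫ x in (-k₀)..k₀, (1 : ℂ) / ((x : ℂ) - k) =
      Complex.log ((k - (k₀ : ℂ)) / (k + (k₀ : ℂ))) := by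
    rw [integral_eq_sub_of_hasDerivAt
      (f := fun x : ℝ => Complex.log ((k - (x : ℂ)) / (k + (k₀ : ℂ)))) ?_
      (hc (fun _ => 1) continuous_const)]
    · push_cast
      rw [sub_neg_eq_add, div_self h0, Complex.log_one, sub_zero]
    · intro x hx
      rw [hu] at hx
      have hd : HasDerivAt (fun x : ℝ => (k - (x : ℂ)) / (k + (k₀ : ℂ)))
          ((-1) / (k + (k₀ : ℂ))) x :=
        ((Complex.ofRealCLM.hasDerivAt (x := x)).const_sub k).div_const _
      refine (hd.clog_real (ratio_slit _ (ratio_aux k₀ hk₀ k hk x hx))).congr_deriv ?_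
      have h2 := hne x hx
      have h3 : k - (x : ℂ) ≠ 0 := by
        intro h3
        apply h2
        linear_combination -h3
      rw [div_div_div_cancel_right₀ h0, div_eq_div_iff h3 h2]
      ring
  refine ⟨ratio_aux k₀ hk₀ k hk k₀ ⟨by linarith, le_refl _⟩, ?_⟩
  have hsplit : ∫ ξ in (-k₀)..k₀, ((h ξ - h k₀ : ℝ) : ℂ) / ((ξ : ℂ) - k) =
      (∫ ξ in (-k₀)..k₀, (h ξ : ℂ) / ((ξ : ℂ) - k)) -
        (h k₀ : ℂ) * ∫ x in (-k₀)..k₀, (1 : ℂ) / ((x : ℂ) - k) := by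
    rw [← intervalIntegral.integral_const_mul, ← intervalIntegral.integral_sub
      (hc (fun x => (h x : ℂ)) (by fun_prop)) ((hc (fun _ => 1) continuous_const).const_mul _)]
    congr 1
    ext x
    push_cast
    ring
  rw [← Complex.exp_add, hsplit, hI]
  congr 1
  have hpi : (Real.pi : ℂ) ≠ 0 := by exact_mod_cast Real.pi_ne_zero
  have hinv : (1 / (2 * Real.pi * Complex.I) : ℂ) = -Complex.I / (2 * Real.pi) := by
    field_simp
    simp
  rw [hinv]
  push_cast
  ring
end
end
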